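/- Let n ≥ 0, m ≥ 3 be integers, let D be a digraph on {1,…,m} with arc set A(D) containing no loops, and let u be a state. Then the outdegree of u in H_n^m(D), i.e., the number of states v such that (u,v) is an arc of H_n^m(D), equals Σ_{(p,q)∈A(D)} x_{P_u^p} · (y_{P_u^p, Q_u^q} − x_{Q_u^q} + 1), where P_u^p = {i : u(i) = p} and Q_u^q = {i : u(i) = q}. -/

import Mathlib

/-- A state of the Tower of Hanoi with `n` discs and `m` pegs is a function assigning to
each disc (smaller index = smaller disc) the peg on which it lies. `(u, v)` is an arc of the
restricted Hanoi graph `H_n^m(D)` moving disc `k` iff (1) only disc `k` changes peg,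
(2) disc `k` is topmost on its peg in `u`, (3) disc `k` becomes topmost on its peg in `v`,
(4) the move of its peg is an arc of the movement digraph with arc set `A`. -/
def HanoiMove {n m : ℕ} (A : Finset (Fin m × Fin m))
    (u v : Fin n → Fin m) (k : Fin n) : Prop :=
  u k ≠ v k ∧ (∀ d, d ≠ k → u d = v d) ∧
    (∀ d, d < k → u d ≠ u k) ∧ (∀ d, d < k → v d ≠ v k) ∧ (u k, v k) ∈ A

/-- `t_k^{n,m}(D)`: the number of arcs of `H_n^m(D)` along which disc `k` is moved.
Here disc `k : Fin n` corresponds to disc `k + 1` of `{1, …, n}` in the paper. -/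
noncomputable def tArcs {n m : ℕ} (A : Finset (Fin m × Fin m)) (k : Fin n) : ℕ :=
  Nat.card {p : (Fin n → Fin m) × (Fin n → Fin m) // HanoiMove A p.1 p.2 k}

/-- `|A(H_n^m(D))|`: the total number of arcs of the restricted Hanoi graph. -/
noncomputable def totalArcs (n m : ℕ) (A : Finset (Fin m × Fin m)) : ℕ :=
  Nat.card {p : (Fin n → Fin m) × (Fin n → Fin m) // ∃ k, HanoiMove A p.1 p.2 k}

/-- `P_u^p`: the set of discs lying on peg `p` in state `u`. -/
def pegSet {n m : ℕ} (u : Fin n → Fin m) (p : Fin m) : Finset (Fin n) :=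
  Finset.univ.filter fun i => u i = p

/-- The indicator `x_A`: `1` if `A ≠ ∅` and `0` otherwise. -/
def xInd {n : ℕ} (A : Finset (Fin n)) : ℤ :=
  if A.Nonempty then 1 else 0

/-- The indicator `y_{A,B}`: `1` if `A ≠ ∅`, `B ≠ ∅` and `min A ≤ min B`, else `0`. -/
def yInd {n : ℕ} (A B : Finset (Fin n)) : ℤ :=
  if A.Nonempty ∧ B.Nonempty ∧ A.min ≤ B.min then 1 else 0

/-- `d⁺(u)`: the outdegree of the state `u` in `H_n^m(D)`, i.e. the number of states `v`
such that `(u, v)` is an arc of `H_n^m(D)`. -/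
noncomputable def outdeg {n m : ℕ} (A : Finset (Fin m × Fin m))
    (u : Fin n → Fin m) : ℕ :=
  Nat.card {v : Fin n → Fin m // ∃ k, HanoiMove A u v k}

/-- The arc `(p, q)` can be used from `u`: the top disc of `p` may be moved to `q`. -/
def Usable {n m : ℕ} (u : Fin n → Fin m) (pq : Fin m × Fin m) : Prop :=
  ∃ k, u k = pq.1 ∧ (∀ d, d < k → u d ≠ pq.1) ∧ (∀ d, d < k → u d ≠ pq.2)

open Classical in
theorem term_eq {n m : ℕ} (u : Fin n → Fin m) (p q : Fin m) :
    xInd (pegSet u p) * (yInd (pegSet u p) (pegSet u q) - xInd (pegSet u q) + 1) =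
      if Usable u (p, q) then 1 else 0 := by
  have memP : ∀ (r : Fin m) (i : Fin n), i ∈ pegSet u r ↔ u i = r := by
    intro r i; simp [pegSet]
  by_cases hP : (pegSet u p).Nonempty
  · obtain ⟨a, ha⟩ := Finset.min_of_nonempty hP
    have hap : u a = p := (memP p a).1 (Finset.mem_of_min ha)
    have hamin : ∀ d, d < a → u d ≠ p := fun d hd h =>
      absurd (Finset.min_le_of_eq ((memP p d).2 h) ha) (not_le.2 hd)
    have key : Usable u (p, q) ↔ ∀ d, d < a → u d ≠ q := by
      constructor
      · rintro ⟨k, h1, h2, h3⟩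
        have : k = a := by
          rcases lt_trichotomy k a with h | h | h
          · exact absurd h1 (hamin k h)
          · exact h
          · exact absurd hap (h2 a h)
        subst this
        exact h3
      · intro h
        exact ⟨a, hap, hamin, h⟩
    by_cases hQ : (pegSet u q).Nonempty
    · obtain ⟨b, hb⟩ := Finset.min_of_nonempty hQ
      have hbq : u b = q := (memP q b).1 (Finset.mem_of_min hb)
      have key2 : (∀ d, d < a → u d ≠ q) ↔ a ≤ b := by
        constructor
        · intro h
          by_contra hlt
          exact h b (not_le.1 hlt) hbq
        · intro h d hd hdq
          exact absurd (Finset.min_le_of_eq ((memP q d).2 hdq) hb)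
            (not_le.2 (lt_of_lt_of_le hd h))
      have key3 : (pegSet u p).min ≤ (pegSet u q).min ↔ a ≤ b := by
        rw [ha, hb]; exact WithTop.coe_le_coe
      simp only [xInd, yInd, hP, hQ, key, key2, key3, true_and, if_true]
      split_ifs <;> norm_num
    · have : ∀ d, d < a → u d ≠ q := fun d _ h => hQ ⟨d, (memP q d).2 h⟩
      rw [if_pos (key.2 this)]
      simp [xInd, yInd, hP, hQ]
  · have : ¬ Usable u (p, q) := fun ⟨k, h, _⟩ => hP ⟨k, (memP p k).2 h⟩
    simp [xInd, hP, this]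

theorem exists_move {n m : ℕ} {A : Finset (Fin m × Fin m)} (hA : ∀ p, (p, p) ∉ A)
    {u : Fin n → Fin m} {pq : Fin m × Fin m} (h : pq ∈ A) (hu : Usable u pq) :
    ∃ v k, HanoiMove A u v k ∧ (u k, v k) = pq := by
  obtain ⟨p, q⟩ := pq
  obtain ⟨k, h1, h2, h3⟩ := hu
  simp only at h1 h2 h3
  refine ⟨Function.update u k q, k, ⟨?_, ?_, ?_, ?_, ?_⟩, ?_⟩
  · rw [Function.update_self, h1]
    rintro rfl
    exact hA _ h
  · intro d hd
    rw [Function.update_of_ne hd]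
  · intro d hd
    rw [h1]; exact h2 d hd
  · intro d hd
    rw [Function.update_of_ne hd.ne, Function.update_self]
    exact h3 d hd
  · rw [Function.update_self, h1]; exact h
  · rw [Function.update_self, h1]

theorem move_inj {n m : ℕ} {A : Finset (Fin m × Fin m)} {u v v' : Fin n → Fin m}
    {k k' : Fin n} (h : HanoiMove A u v k) (h' : HanoiMove A u v' k')
    (e : (u k, v k) = (u k', v' k')) : v = v' := by
  obtain ⟨_, h2, h3, _, _⟩ := h
  obtain ⟨_, h2', h3', _, _⟩ := h'
  obtain ⟨e1, e2⟩ := Prod.mk.inj e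
  have : k = k' := by
    rcases lt_trichotomy k k' with h | h | h
    · exact absurd e1 (h3' k h)
    · exact h
    · exact absurd e1.symm (h3 k' h)
  subst this
  funext d
  by_cases hd : d = k
  · rw [hd, e2]
  · rw [← h2 d hd, ← h2' d hd]

theorem move_disc {n m : ℕ} {A : Finset (Fin m × Fin m)} {u v : Fin n → Fin m}
    {k k' : Fin n} (h : HanoiMove A u v k) (h' : HanoiMove A u v k') : k = k' := by
  by_contra hne
  exact h.1 (h'.2.1 k hne)

theorem usable_of_move {n m : ℕ} {A : Finset (Fin m × Fin m)} {u v : Fin n → Fin m}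
    {k : Fin n} (h : HanoiMove A u v k) : Usable u (u k, v k) :=
  ⟨k, rfl, h.2.2.1, fun d hd => by
    rw [h.2.1 d hd.ne]; exact h.2.2.2.1 d hd⟩

/-- `d⁺(u) = Σ_{(p,q) ∈ A(D)} x_{P_u^p} · (y_{P_u^p, Q_u^q} - x_{Q_u^q} + 1)`. -/
theorem outdeg_formula (n m : ℕ) (hm : 3 ≤ m) (A : Finset (Fin m × Fin m))
    (hA : ∀ p, (p, p) ∉ A) (u : Fin n → Fin m) :
    (outdeg A u : ℤ) =
      ∑ pq ∈ A,
        xInd (pegSet u pq.1) *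
          (yInd (pegSet u pq.1) (pegSet u pq.2) - xInd (pegSet u pq.2) + 1) := by
  classical
  rw [Finset.sum_congr rfl (fun pq _ => term_eq u pq.1 pq.2), Finset.sum_boole]
  unfold outdeg
  rw [Nat.card_eq_fintype_card, Fintype.card_subtype]
  congr 1
  refine Finset.card_bij
    (fun v hv => (u (Finset.mem_filter.1 hv).2.choose, v (Finset.mem_filter.1 hv).2.choose))
    ?_ ?_ ?_
  · intro v hv
    have h := (Finset.mem_filter.1 hv).2.choose_spec
    exact Finset.mem_filter.2 ⟨h.2.2.2.2, usable_of_move h⟩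
  · intro v hv v' hv' e
    exact move_inj (Finset.mem_filter.1 hv).2.choose_spec
      (Finset.mem_filter.1 hv').2.choose_spec e
  · intro pq hpq
    obtain ⟨h, hu⟩ := Finset.mem_filter.1 hpq
    obtain ⟨v, k, hk, e⟩ := exists_move hA h hu
    have hv : v ∈ Finset.univ.filter (fun v => ∃ k, HanoiMove A u v k) :=
      Finset.mem_filter.2 ⟨Finset.mem_univ _, k, hk⟩
    refine ⟨v, hv, ?_⟩
    have := move_disc (Finset.mem_filter.1 hv).2.choose_spec hk
    rw [← e]
    simp only [this]
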